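/- arXiv:2204.12571 — 8 statements merged into one kernel-verified Lean document; each statement's English description precedes it below -/
import Mathlib

section
/- Let R be a rack and let A be a subset of R that generates R (i.e., the smallest subset of R containing A and closed under the rack operation and its right inverse operation is all of R). Then every element u of R can be written as a left-normed product u = (…((a₁ ⋆^{ε₁} a₂) ⋆^{ε₂} a₃) ⋆^{ε₃} …) ⋆^{ε_{m-1}} a_m for some m ≥ 1, elements a₁, …, a_m ∈ A, and signs ε₁, …, ε_{m-1} ∈ {1, −1}, where x ⋆^{1} y denotes the rack operation x ⋆ y and x ⋆^{−1} y denotes its right inverse operation. -/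
/-- The left-normed products of elements of `A`, formed with `op` and `inv`. -/
inductive IsLeftNormed {R : Type*} (op inv : R → R → R) (A : Set R) : R → Prop
  | of {a : R} (ha : a ∈ A) : IsLeftNormed op inv A a
  | op_right {x a : R} (hx : IsLeftNormed op inv A x) (ha : a ∈ A) :
      IsLeftNormed op inv A (op x a)
  | inv_right {x a : R} (hx : IsLeftNormed op inv A x) (ha : a ∈ A) :
      IsLeftNormed op inv A (inv x a)

/-- Left-normed products in a rack are closed under both operations. -/
theorem IsLeftNormed.op_and_inv {R : Type*} {op inv : R → R → R}
    (hinv₁ : ∀ a b : R, inv (op a b) b = a)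
    (hinv₂ : ∀ a b : R, op (inv a b) b = a)
    (hdist : ∀ a b c : R, op (op a b) c = op (op a c) (op b c))
    {A : Set R} {y : R} (hy : IsLeftNormed op inv A y) :
    ∀ {x : R}, IsLeftNormed op inv A x →
      IsLeftNormed op inv A (op x y) ∧ IsLeftNormed op inv A (inv x y) := by
  induction hy with
  | of ha => exact fun hx => ⟨hx.op_right ha, hx.inv_right ha⟩
  | @op_right y a _ ha ih =>
    intro x hx
    have h_op : op x (op y a) = op (op (inv x a) y) a := by rw [hdist, hinv₂]
    have h_inv : inv x (op y a) = op (inv (inv x a) y) a := by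
      rw [← hinv₁ (op (inv (inv x a) y) a) (op y a), ← hdist, hinv₂, hinv₂]
    rw [h_op, h_inv]
    exact ⟨(ih (hx.inv_right ha)).1.op_right ha, (ih (hx.inv_right ha)).2.op_right ha⟩
  | @inv_right y a _ ha ih =>
    intro x hx
    have h_op : op x (inv y a) = inv (op (op x a) y) a := by
      rw [← hinv₁ (op x (inv y a)) a, hdist, hinv₂]
    have h_inv : inv x (inv y a) = inv (inv (op x a) y) a := by
      have h := hdist (inv x (inv y a)) (inv y a) a
      rw [hinv₂, hinv₂] at h
      rw [h, hinv₁, hinv₁]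
    rw [h_op, h_inv]
    exact ⟨(ih (hx.op_right ha)).1.inv_right ha, (ih (hx.op_right ha)).2.inv_right ha⟩

/-- A left-normed product extended by one more signed factor is again an iterated product. -/
theorem exists_foldl_snoc {R : Type*} {op inv : R → R → R} {A : Set R} {x b : R} (s : Bool)
    (hb : b ∈ A)
    (hx : ∃ (m : ℕ) (a : Fin (m + 1) → R) (ε : Fin m → Bool), (∀ i, a i ∈ A) ∧
      x = Fin.foldl m
        (fun acc i => if ε i then op acc (a i.succ) else inv acc (a i.succ)) (a 0)) :
    ∃ (m : ℕ) (a : Fin (m + 1) → R) (ε : Fin m → Bool), (∀ i, a i ∈ A) ∧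
      (if s then op x b else inv x b) = Fin.foldl m
        (fun acc i => if ε i then op acc (a i.succ) else inv acc (a i.succ)) (a 0) := by
  obtain ⟨m, a, ε, ha, rfl⟩ := hx
  refine ⟨m + 1, Fin.snoc (α := fun _ => R) a b, Fin.snoc (α := fun _ => Bool) ε s, ?_, ?_⟩
  · intro i
    refine Fin.lastCases ?_ (fun j => ?_) i
    · simpa using hb
    · simpa using ha j
  · have h_zero : Fin.snoc (α := fun _ => R) a b 0 = a 0 :=
      Fin.snoc_castSucc (α := fun _ => R) b a 0
    rw [Fin.foldl_succ_last, h_zero]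
    simp only [Fin.succ_castSucc, Fin.snoc_castSucc, Fin.succ_last, Fin.snoc_last]

/-- Every left-normed product is an iterated product over a finite sequence. -/
theorem IsLeftNormed.exists_foldl {R : Type*} {op inv : R → R → R} {A : Set R} {u : R}
    (hu : IsLeftNormed op inv A u) :
    ∃ (m : ℕ) (a : Fin (m + 1) → R) (ε : Fin m → Bool), (∀ i, a i ∈ A) ∧
      u = Fin.foldl m
        (fun acc i => if ε i then op acc (a i.succ) else inv acc (a i.succ)) (a 0) := by
  induction hu with
  | @of a ha => exact ⟨0, fun _ => a, Fin.elim0, fun _ => ha, by simp⟩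
  | op_right _ ha ih => simpa using exists_foldl_snoc true ha ih
  | inv_right _ ha ih => simpa using exists_foldl_snoc false ha ih


/-- A rack, presented by its operation `op` together with the right inverse
operation `inv`, satisfying `(a ⋆ b) ⋆⁻¹ b = a = (a ⋆⁻¹ b) ⋆ b` and
self-distributivity of `⋆`.  Every element of a rack generated by a subset `A`
is a left-normed product of elements of `A`. -/
theorem rack_normal_form {R : Type*} [Nonempty R] (op inv : R → R → R)
    (hinv₁ : ∀ a b : R, inv (op a b) b = a)
    (hinv₂ : ∀ a b : R, op (inv a b) b = a)
    (hdist : ∀ a b c : R, op (op a b) c = op (op a c) (op b c))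
    (A : Set R)
    (hgen : ∀ S : Set R, A ⊆ S →
      (∀ a ∈ S, ∀ b ∈ S, op a b ∈ S) → (∀ a ∈ S, ∀ b ∈ S, inv a b ∈ S) →
      ∀ x : R, x ∈ S) :
    ∀ u : R, ∃ (m : ℕ) (a : Fin (m + 1) → R) (ε : Fin m → Bool),
      (∀ i, a i ∈ A) ∧
      u = Fin.foldl m
        (fun acc i => if ε i then op acc (a i.succ) else inv acc (a i.succ))
        (a 0) := by
  exact fun u => IsLeftNormed.exists_foldl <|
    hgen {x | IsLeftNormed op inv A x} (fun _ ha => .of ha)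
      (fun _ hx _ hy => (hy.op_and_inv hinv₁ hinv₂ hdist hx).1)
      (fun _ hx _ hy => (hy.op_and_inv hinv₁ hinv₂ hdist hx).2) u
end

section
/- Let H be a group. On the set H × Aut(H), the binary operation (x, φ) · (y, ψ) = (ψ(x y⁻¹) y, ψ∘φ∘ψ⁻¹) is a quandle operation, i.e., it satisfies idempotency, every right translation (x,φ) ↦ (x,φ)·(y,ψ) is a bijection, and it is self-distributive. -/
/-- A binary operation is a quandle operation: idempotent, right translations
are bijections, and self-distributive. -/
structure IsQuandleOp {Q : Type*} (op : Q → Q → Q) : Prop where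
  idem : ∀ x, op x x = x
  rightBij : ∀ y, Function.Bijective fun x => op x y
  selfDistrib : ∀ x y z, op (op x y) z = op (op x z) (op y z)

/-- Remark 3.8 of the paper: on the set `H × Aut(H)` the operation
`(x,φ) · (y,ψ) = (ψ(x y⁻¹) y, ψ∘φ∘ψ⁻¹)` is a quandle operation
(`ψ.symm.trans (φ.trans ψ)` is the composite `ψ∘φ∘ψ⁻¹`). -/
theorem holomorph_quandle {H : Type*} [Group H] :
    IsQuandleOp (fun p q : H × (H ≃* H) =>
      (q.2 (p.1 * q.1⁻¹) * q.1, q.2.symm.trans (p.2.trans q.2))) := by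
  refine ⟨?_, ?_, ?_⟩
  · rintro ⟨x, φ⟩
    ext <;> simp
  · rintro ⟨y, ψ⟩
    refine Function.bijective_iff_has_inverse.mpr
      ⟨fun p => (ψ.symm (p.1 * y⁻¹) * y, ψ.trans (p.2.trans ψ.symm)), ?_, ?_⟩ <;>
    · rintro ⟨x, φ⟩
      ext <;> simp
  · rintro ⟨x, φ⟩ ⟨y, ψ⟩ ⟨z, θ⟩
    ext <;> simp [mul_assoc]
end

section
/- Let Q be a set and let ∘ and * be two quandle operations on Q that are distributive with respect to each other, i.e., (a ∘ b) * c = (a * c) ∘ (b * c) and (a * b) ∘ c = (a ∘ c) * (b ∘ c) for all a, b, c ∈ Q. For b ∈ Q let σ_b and τ_b denote the bijections x ↦ x ∘ b and x ↦ x * b of Q. For any finite word w = ((ε₁, n₁), …, (ε_k, n_k)) with each εᵢ ∈ {∘, *} and nᵢ ∈ ℤ, define the operation x ⋆_w y = ρ_{ε_k, y}^{n_k}( … (ρ_{ε₁, y}^{n₁}(x)) … ), where ρ_{∘, y} = σ_y and ρ_{*, y} = τ_y and integer powers are taken in the group of permutations of Q. Then ⋆_w is a quandle operation on Q. -/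
namespace RightTranslations

open Equiv

variable {Q ι : Type*}

/-- The permutations of `Q` that conjugate each right translation `ρ i y` to the right translation
at the image of `y`, i.e. the common automorphisms of the operations `(x, y) ↦ ρ i y x`. -/
def automorphisms (ρ : ι → Q → Perm Q) : Subgroup (Perm Q) where
  carrier := {g | ∀ i y, MulAut.conj g (ρ i y) = ρ i (g y)}
  one_mem' i y := by simp
  mul_mem' hg hh i y := by rw [map_mul, MulAut.mul_apply, hh, hg, Perm.mul_apply]
  inv_mem' {g} hg i y := by
    rw [map_inv, MulAut.inv_apply, MulEquiv.symm_apply_eq, hg]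
    simp

/-- The right translation by `y` of the operation defined by the word `w`. -/
def word (ρ : ι → Q → Perm Q) : List (ι × ℤ) → Q → Perm Q
  | [], _ => 1
  | p :: w, y => word ρ w y * ρ p.1 y ^ p.2

variable {ρ : ι → Q → Perm Q}

theorem word_apply (w : List (ι × ℤ)) (x y : Q) :
    word ρ w y x = w.foldl (fun acc p => (ρ p.1 y ^ p.2) acc) x := by
  induction w generalizing x with
  | nil => rfl
  | cons p w ih => exact ih _

theorem word_apply_self (hidem : ∀ i x, ρ i x x = x) (w : List (ι × ℤ)) (x : Q) :
    word ρ w x x = x := by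
  induction w with
  | nil => rfl
  | cons p w ih =>
    rw [word, Perm.mul_apply, Perm.zpow_apply_eq_self_of_apply_eq_self (hidem _ _), ih]

theorem word_mem_automorphisms (hρ : ∀ i y, ρ i y ∈ automorphisms ρ) (w : List (ι × ℤ)) (y : Q) :
    word ρ w y ∈ automorphisms ρ := by
  induction w with
  | nil => exact one_mem _
  | cons p w ih => exact mul_mem ih (zpow_mem (hρ _ _) _)

theorem conj_word {g : Perm Q} (hg : g ∈ automorphisms ρ) (w : List (ι × ℤ)) (y : Q) :
    MulAut.conj g (word ρ w y) = word ρ w (g y) := by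
  induction w with
  | nil => exact map_one _
  | cons p w ih => rw [word, map_mul, map_zpow, ih, hg, word]

theorem isQuandleOp_word (hidem : ∀ i x, ρ i x x = x) (hρ : ∀ i y, ρ i y ∈ automorphisms ρ)
    (w : List (ι × ℤ)) : IsQuandleOp fun x y => word ρ w y x where
  idem := word_apply_self hidem w
  rightBij y := (word ρ w y).bijective
  selfDistrib x y z := by
    rw [← conj_word (word_mem_automorphisms hρ w z)]
    simp

end RightTranslations

/-- Theorem 4.12 of the paper: if the quandle operations `∘` and `*` on `Q`
are distributive with respect to each other, then any finite word in the
alphabet `{∘, *, ∘⁻¹, *⁻¹}` defines a quandle operation on `Q`.  A word is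
encoded as a list of pairs `(ε, n)` with `ε : Bool` selecting the operation
(`true` for `∘`, `false` for `*`) and `n : ℤ` the (possibly negative) power;
`σ b`, `τ b` are the right translation permutations `x ↦ x ∘ b`, `x ↦ x * b`
and integer powers are taken in the permutation group of `Q`. -/
theorem word_operation_is_quandle {Q : Type*}
    (circ star : Q → Q → Q)
    (hcirc : IsQuandleOp circ) (hstar : IsQuandleOp star)
    (hdist₁ : ∀ a b c : Q, star (circ a b) c = circ (star a c) (star b c))
    (hdist₂ : ∀ a b c : Q, circ (star a b) c = star (circ a c) (circ b c))
    (σ τ : Q → Equiv.Perm Q)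
    (hσ : ∀ b x : Q, σ b x = circ x b)
    (hτ : ∀ b x : Q, τ b x = star x b) :
    ∀ w : List (Bool × ℤ),
      IsQuandleOp (fun x y =>
        w.foldl (fun acc p => (((if p.1 then σ y else τ y) ^ p.2)) acc) x) := by
  intro w
  simp only [← Bool.cond_eq_ite]
  let ρ : Bool → Q → Equiv.Perm Q := fun i y => cond i (σ y) (τ y)
  suffices h : IsQuandleOp fun x y => RightTranslations.word ρ w y x by
    simpa only [RightTranslations.word_apply] using h
  refine RightTranslations.isQuandleOp_word ?_ ?_ w
  · rintro (_ | _) x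
    · exact (hτ x x).trans (hstar.idem x)
    · exact (hσ x x).trans (hcirc.idem x)
  · intro i z j y
    rw [MulAut.conj_apply, mul_inv_eq_iff_eq_mul]
    ext x
    cases i <;> cases j <;>
      simp only [ρ, cond_true, cond_false, Equiv.Perm.mul_apply, hσ, hτ]
    exacts [hstar.selfDistrib x y z, hdist₁ x y z, hdist₂ x y z, hcirc.selfDistrib x y z]
end

section
/- Let Q be a set, Λ an index set, and for each α ∈ Λ let *_α be a quandle operation on Q such that for all α, β ∈ Λ the operation *_α is distributive with respect to *_β, i.e., (a *_β b) *_α c = (a *_α c) *_β (b *_α c) for all a, b, c ∈ Q. For α ∈ Λ and b ∈ Q let σ_{α,b} denote the bijection x ↦ x *_α b of Q. For any finite word w = ((α₁, n₁), …, (α_k, n_k)) with αᵢ ∈ Λ and nᵢ ∈ ℤ, define x ⋆_w y = σ_{α_k, y}^{n_k}( … (σ_{α₁, y}^{n₁}(x)) … ), where integer powers are taken in the group of permutations of Q. Then for every word w the operation ⋆_w is a quandle operation on Q, and for any two words w, w' the operation ⋆_w is distributive with respect to ⋆_{w'}. -/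
/-- The permutations which commute with every right translation `σ α b`, up to moving the
base point `b`: the common automorphisms of all the operations `x ↦ σ α b x`. -/
def translationAut {Q Λ : Type*} (σ : Λ → Q → Equiv.Perm Q) : Subgroup (Equiv.Perm Q) where
  carrier := {g | ∀ α b, SemiconjBy g (σ α b) (σ α (g b))}
  one_mem' := fun α b => SemiconjBy.one_left (σ α b)
  mul_mem' := fun {_ h} hg hh α b => (hg α (h b)).mul_left (hh α b)
  inv_mem' := by
    intro g hg α b
    simpa using (hg α (g⁻¹ b)).inv_symm_left

/-- The right translation by `y` of the operation attached to the word `w`. -/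
def wordTranslation {Q Λ : Type*} (σ : Λ → Q → Equiv.Perm Q) (y : Q) :
    List (Λ × ℤ) → Equiv.Perm Q
  | [] => 1
  | p :: w => wordTranslation σ y w * σ p.1 y ^ p.2

section WordTranslation

variable {Q Λ : Type*} {σ : Λ → Q → Equiv.Perm Q}

theorem foldl_eq_wordTranslation (w : List (Λ × ℤ)) (x y : Q) :
    w.foldl (fun acc p => (σ p.1 y ^ p.2) acc) x = wordTranslation σ y w x := by
  induction w generalizing x with
  | nil => rfl
  | cons p w ih => exact ih _

theorem wordTranslation_mem_translationAut (h : ∀ α b, σ α b ∈ translationAut σ) (y : Q)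
    (w : List (Λ × ℤ)) : wordTranslation σ y w ∈ translationAut σ := by
  induction w with
  | nil => exact one_mem _
  | cons p w ih => exact mul_mem ih (zpow_mem (h _ _) _)

theorem semiconjBy_wordTranslation {g : Equiv.Perm Q} (hg : g ∈ translationAut σ) (y : Q)
    (w : List (Λ × ℤ)) :
    SemiconjBy g (wordTranslation σ y w) (wordTranslation σ (g y) w) := by
  induction w with
  | nil => exact SemiconjBy.one_right g
  | cons p w ih => exact ih.mul_right ((hg p.1 y).zpow_right p.2)

theorem wordTranslation_apply_self (h : ∀ α x, σ α x x = x) (x : Q) (w : List (Λ × ℤ)) :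
    wordTranslation σ x w x = x := by
  induction w with
  | nil => rfl
  | cons p w ih =>
    have hp : (σ p.1 x ^ p.2) x = x := Equiv.Perm.zpow_apply_eq_self_of_apply_eq_self (h p.1 x) p.2
    rw [wordTranslation, Equiv.Perm.mul_apply, hp, ih]

theorem wordTranslation_distrib (h : ∀ α b, σ α b ∈ translationAut σ) (w w' : List (Λ × ℤ))
    (a b c : Q) :
    wordTranslation σ c w (wordTranslation σ b w' a) =
      wordTranslation σ (wordTranslation σ c w b) w' (wordTranslation σ c w a) :=
  DFunLike.congr_fun
    (semiconjBy_wordTranslation (wordTranslation_mem_translationAut h c w) b w').eq a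

end WordTranslation

/-- Theorem 4.13 of the paper: given a family of quandle operations `*_α`,
`α ∈ Λ`, on `Q` which are pairwise distributive with respect to each other,
every word operation `⋆_w` (for `w` a finite word in the `*_α` and their
inverses, encoded as a list of pairs `(α, n)` with `n : ℤ`) is a quandle
operation, and any two word operations are distributive with respect to each
other.  Here `σ α b` is the right translation permutation `x ↦ x *_α b` and
integer powers are taken in the permutation group of `Q`. -/
theorem word_operations_closed {Q Λ : Type*}
    (op : Λ → Q → Q → Q)
    (hop : ∀ α, IsQuandleOp (op α))
    (hdist : ∀ α β : Λ, ∀ a b c : Q,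
      op α (op β a b) c = op β (op α a c) (op α b c))
    (σ : Λ → Q → Equiv.Perm Q)
    (hσ : ∀ (α : Λ) (b x : Q), σ α b x = op α x b) :
    ∀ w : List (Λ × ℤ),
      IsQuandleOp (fun x y => w.foldl (fun acc p => ((σ p.1 y ^ p.2)) acc) x) ∧
      ∀ w' : List (Λ × ℤ), ∀ a b c : Q,
        (fun x y => w.foldl (fun acc p => ((σ p.1 y ^ p.2)) acc) x)
          ((fun x y => w'.foldl (fun acc p => ((σ p.1 y ^ p.2)) acc) x) a b) c
        = (fun x y => w'.foldl (fun acc p => ((σ p.1 y ^ p.2)) acc) x)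
            ((fun x y => w.foldl (fun acc p => ((σ p.1 y ^ p.2)) acc) x) a c)
            ((fun x y => w.foldl (fun acc p => ((σ p.1 y ^ p.2)) acc) x) b c) := by
  have haut : ∀ α b, σ α b ∈ translationAut σ := by
    intro α c β b
    ext a
    simp only [Equiv.Perm.mul_apply, hσ]
    exact hdist α β a b c
  have hidem : ∀ α x, σ α x x = x := fun α x => (hσ α x x).trans ((hop α).idem x)
  intro w
  simp only [foldl_eq_wordTranslation]
  exact ⟨⟨fun x => wordTranslation_apply_self hidem x w,
    fun y => (wordTranslation σ y w).bijective,
    wordTranslation_distrib haut w w⟩, wordTranslation_distrib haut w⟩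
end

section
/- Let Q be a set, Λ an index set, and for each α ∈ Λ let *_α be a quandle operation on Q such that for all α, β ∈ Λ the operation *_α is distributive with respect to *_β, i.e., (a *_β b) *_α c = (a *_α c) *_β (b *_α c) for all a, b, c ∈ Q. For α ∈ Λ and b ∈ Q let σ_{α,b} denote the bijection x ↦ x *_α b of Q, and for a finite word w = ((α₁, n₁), …, (α_k, n_k)) with αᵢ ∈ Λ, nᵢ ∈ ℤ, define x ⋆_w y = σ_{α_k, y}^{n_k}( … (σ_{α₁, y}^{n₁}(x)) … ). Then the quandle multiplication is commutative: for any two words w, w' and all x, y ∈ Q, (x ⋆_w y) ⋆_{w'} y = (x ⋆_{w'} y) ⋆_w y. -/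
/-- Right translations by the same element commute, for mutually distributive idempotent
operations. -/
theorem commute_rightTranslation {Q Λ : Type*} {op : Λ → Q → Q → Q}
    (hidem : ∀ α x, op α x x = x)
    (hdist : ∀ α β : Λ, ∀ a b c : Q,
      op α (op β a b) c = op β (op α a c) (op α b c))
    {σ : Λ → Q → Equiv.Perm Q} (hσ : ∀ (α : Λ) (b x : Q), σ α b x = op α x b)
    (α β : Λ) (y : Q) : Commute (σ α y) (σ β y) := by
  ext x
  simp only [Equiv.Perm.mul_apply, hσ, hdist α β, hidem]

/-- Two iterated applications of pairwise commuting maps can be interchanged. -/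
theorem List.foldl_foldl_comm {α β : Type*} {f : α → β → α}
    (hf : ∀ a b c, f (f a b) c = f (f a c) b) (l l' : List β) (a : α) :
    l'.foldl f (l.foldl f a) = l.foldl f (l'.foldl f a) := by
  have : RightCommutative f := ⟨hf⟩
  rw [← List.foldl_append, ← List.foldl_append]
  exact List.perm_append_comm.foldl_eq a

/-- Corollary 4.16 of the paper: for a family of quandle operations `*_α` on
`Q` which are pairwise distributive with respect to each other, the quandle
multiplication of the word operations is commutative:
`(x ⋆_w y) ⋆_{w'} y = (x ⋆_{w'} y) ⋆_w y`.  A word `w` is a list of pairs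
`(α, n)` with `n : ℤ`, `σ α b` is the right translation permutation
`x ↦ x *_α b`, and integer powers are taken in the permutation group of
`Q`. -/
theorem word_multiplication_commutative {Q Λ : Type*}
    (op : Λ → Q → Q → Q)
    (hop : ∀ α, IsQuandleOp (op α))
    (hdist : ∀ α β : Λ, ∀ a b c : Q,
      op α (op β a b) c = op β (op α a c) (op α b c))
    (σ : Λ → Q → Equiv.Perm Q)
    (hσ : ∀ (α : Λ) (b x : Q), σ α b x = op α x b) :
    ∀ w w' : List (Λ × ℤ), ∀ x y : Q,
      w'.foldl (fun acc p => ((σ p.1 y ^ p.2)) acc)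
          (w.foldl (fun acc p => ((σ p.1 y ^ p.2)) acc) x)
        = w.foldl (fun acc p => ((σ p.1 y ^ p.2)) acc)
            (w'.foldl (fun acc p => ((σ p.1 y ^ p.2)) acc) x) := by
  intro w w' x y
  refine List.foldl_foldl_comm (fun a p q => ?_) w w' x
  have h := (commute_rightTranslation (fun α => (hop α).idem) hdist hσ q.1 p.1 y).zpow_zpow q.2 p.2
  simpa only [Equiv.Perm.mul_apply] using Equiv.congr_fun h.eq a
end

section
/- Let G be a group in which the square of every element lies in the center, i.e., g² ∈ Z(G) for all g ∈ G. Define on G the conjugation operation a * b = b⁻¹ a b and the core operation a ∘ b = b a⁻¹ b. Then for all a, b, c ∈ G: (a * b) ∘ c = (a ∘ c) * (b ∘ c), i.e., the core operation is distributive with respect to the conjugation operation. -/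
/-- The conjugation quandle operation `a * b = b⁻¹ a b` on a group. -/
def conjOp {G : Type*} [Group G] (a b : G) : G := b⁻¹ * a * b

/-- The core quandle operation `a ∘ b = b a⁻¹ b` on a group. -/
def coreOp {G : Type*} [Group G] (a b : G) : G := b * a⁻¹ * b

/-- Identity (4.2) of the paper: if the square of every element of `G` lies in
the center, then the core operation is distributive with respect to the
conjugation operation: `(a * b) ∘ c = (a ∘ c) * (b ∘ c)`. -/
theorem core_distrib_conj {G : Type*} [Group G]
    (hsq : ∀ g : G, g ^ 2 ∈ Subgroup.center G) :
    ∀ a b c : G, coreOp (conjOp a b) c = conjOp (coreOp a c) (coreOp b c) := by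
  intro a b c
  have comm (g x : G) : x * g ^ 2 = g ^ 2 * x := Subgroup.mem_center_iff.mp (hsq g) x
  have conj_inv : b⁻¹ * a⁻¹ * b = b * a⁻¹ * b⁻¹ := by
    calc b⁻¹ * a⁻¹ * b = b⁻¹ * (a⁻¹ * b ^ 2) * b⁻¹ := by group
      _ = b⁻¹ * (b ^ 2 * a⁻¹) * b⁻¹ := by rw [comm]
      _ = b * a⁻¹ * b⁻¹ := by group
  calc coreOp (conjOp a b) c = c * (b⁻¹ * a⁻¹ * b) * c := by
        simp only [coreOp, conjOp]; group
    _ = c * (b * a⁻¹ * b⁻¹) * c := by rw [conj_inv]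
    _ = c⁻¹ * (c ^ 2 * (b * a⁻¹)) * b⁻¹ * c := by group
    _ = c⁻¹ * (b * a⁻¹ * c ^ 2) * b⁻¹ * c := by rw [comm]
    _ = conjOp (coreOp a c) (coreOp b c) := by
        simp only [coreOp, conjOp, pow_two]; group
end

section
/- Let G be a group and let φ, ψ be automorphisms of G with φ∘ψ = ψ∘φ. Define on G the operations a * b = φ(a b⁻¹) b and a ∘ b = ψ(a b⁻¹) b. Then the operations are distributive with respect to each other: (a * b) ∘ c = (a ∘ c) * (b ∘ c) and (a ∘ b) * c = (a * c) ∘ (b * c) for all a, b, c ∈ G. -/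
/-- The generalized Alexander operation `a * b = φ(a b⁻¹) b` on a group `G`,
for an automorphism `φ` of `G`. -/
def alexOp {G : Type*} [Group G] (φ : G ≃* G) (a b : G) : G :=
  φ (a * b⁻¹) * b

/-- If `φ` and `ψ` commute, then `alexOp ψ` is right distributive over `alexOp φ`. -/
theorem alexOp_alexOp_distrib {G : Type*} [Group G] {φ ψ : G ≃* G}
    (hcomm : ∀ x : G, φ (ψ x) = ψ (φ x)) (a b c : G) :
    alexOp ψ (alexOp φ a b) c = alexOp φ (alexOp ψ a c) (alexOp ψ b c) := by
  simp [alexOp, hcomm, mul_assoc]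

/-- Part of the proof of Proposition 4.20 of the paper: if `φ` and `ψ` are
commuting automorphisms of `G`, then the generalized Alexander operations
`a * b = φ(a b⁻¹) b` and `a ∘ b = ψ(a b⁻¹) b` are distributive with respect
to each other. -/
theorem commuting_alexander_distributive {G : Type*} [Group G]
    (φ ψ : G ≃* G) (hcomm : ∀ x : G, φ (ψ x) = ψ (φ x)) :
    (∀ a b c : G,
      alexOp ψ (alexOp φ a b) c = alexOp φ (alexOp ψ a c) (alexOp ψ b c)) ∧
    (∀ a b c : G,
      alexOp φ (alexOp ψ a b) c = alexOp ψ (alexOp φ a c) (alexOp φ b c)) :=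
  ⟨alexOp_alexOp_distrib hcomm, alexOp_alexOp_distrib fun x => (hcomm x).symm⟩
end

section
/- Let G be a group and let φ, ψ be automorphisms of G with φ∘ψ = ψ∘φ. Define on G the operations a * b = φ(a b⁻¹) b and a ∘ b = ψ(a b⁻¹) b, and for b ∈ G let σ_b and τ_b denote the bijections x ↦ x * b and x ↦ x ∘ b of G. Then for any integers k, l, the operation a ⋆ b = τ_b^l(σ_b^k(a)), where integer powers are taken in the group of permutations of G, is a quandle operation on G, i.e., (G, *^k ∘^l) is a quandle. -/
theorem isQuandleOp_alexOp {G : Type*} [Group G] (φ : G ≃* G) : IsQuandleOp (alexOp φ) where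
  idem x := by simp [alexOp]
  rightBij y :=
    (Equiv.mulRight y).bijective.comp (φ.bijective.comp (Equiv.mulRight y⁻¹).bijective)
  selfDistrib x y z := by simp [alexOp, mul_assoc]

theorem zpow_apply_eq_alexOp {G : Type*} [Group G] (φ : MulAut G) (b : G) (σ : Equiv.Perm G)
    (hσ : ∀ x, σ x = alexOp φ x b) (k : ℤ) (x : G) : (σ ^ k) x = alexOp (φ ^ k) x b := by
  have hconj : σ = Equiv.mulRight b * MulAut.toPerm G φ * (Equiv.mulRight b)⁻¹ := by
    ext x
    rw [hσ]
    rfl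
  rw [hconj, conj_zpow, ← map_zpow]
  rfl

theorem alexOp_alexOp_same_right {G : Type*} [Group G] (φ ψ : MulAut G) (a b : G) :
    alexOp ψ (alexOp φ a b) b = alexOp (ψ * φ) a b := by
  simp [alexOp]

/-- Proposition 4.20 of the paper: if `φ` and `ψ` are commuting automorphisms
of `G`, with associated generalized Alexander operations
`a * b = φ(a b⁻¹) b` and `a ∘ b = ψ(a b⁻¹) b`, then for all integers `k, l`
the operation `a ⋆ b = (a *ᵏ b) ∘ˡ b` is a quandle operation on `G`.  Here
`σ b`, `τ b` are the right translation permutations `x ↦ x * b`, `x ↦ x ∘ b`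
and integer powers are taken in the permutation group of `G`. -/
theorem commuting_alexander_powers_quandle {G : Type*} [Group G]
    (φ ψ : G ≃* G) (hcomm : ∀ x : G, φ (ψ x) = ψ (φ x))
    (σ τ : G → Equiv.Perm G)
    (hσ : ∀ b x : G, σ b x = alexOp φ x b)
    (hτ : ∀ b x : G, τ b x = alexOp ψ x b) :
    ∀ k l : ℤ, IsQuandleOp (fun a b : G => (τ b ^ l) ((σ b ^ k) a)) := by
  intro k l
  have hop : (fun a b : G => (τ b ^ l) ((σ b ^ k) a)) =
      alexOp ((ψ : MulAut G) ^ l * (φ : MulAut G) ^ k) := by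
    funext a b
    rw [zpow_apply_eq_alexOp φ b (σ b) (hσ b), zpow_apply_eq_alexOp ψ b (τ b) (hτ b),
      alexOp_alexOp_same_right]
  rw [hop]
  exact isQuandleOp_alexOp _
end
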